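/- arXiv:2306.02511 — 9 statements merged into one kernel-verified Lean document; each statement's English description precedes it below -/
import Mathlib

section
/- Let G be a finite simple graph with n ≥ 1 vertices, let a ≤ b be real numbers, and let F_V : ℕ → ℝ satisfy e^a ≤ F_V(d_u) ≤ e^b for every vertex u ∈ V(G). Then (1/n) · X_{Σ,F_V}(G) ≤ e^a + e^b − e^{a+b} / (X_{Π,F_V}(G))^{1/n}. -/
/-- Converse Jensen-type inequality (vertex version): for a finite simple graph `G` with
`n ≥ 1` vertices and a vertex function `F_V` with `e^a ≤ F_V(d_u) ≤ e^b` for all vertices,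
`(1/n) · X_{Σ,F_V}(G) ≤ e^a + e^b − e^{a+b} / X_{Π,F_V}(G)^{1/n}`. -/
theorem converse_jensen_vertex {V : Type*} [Fintype V] (G : SimpleGraph V)
    [DecidableRel G.Adj] (hn : 1 ≤ Fintype.card V) (a b : ℝ) (hab : a ≤ b)
    (F : ℕ → ℝ)
    (hF : ∀ u : V, Real.exp a ≤ F (G.degree u) ∧ F (G.degree u) ≤ Real.exp b) :
    (1 / (Fintype.card V : ℝ)) * ∑ u : V, F (G.degree u) ≤
      Real.exp a + Real.exp b -
        Real.exp (a + b) /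
          (∏ u : V, F (G.degree u)) ^ ((1 : ℝ) / (Fintype.card V : ℝ)) := by
  have hc : (0 : ℝ) < (Fintype.card V : ℝ) := by exact_mod_cast hn
  have hpos : ∀ u : V, 0 < F (G.degree u) := fun u => lt_of_lt_of_le (Real.exp_pos a) (hF u).1
  have hpt : ∀ u : V, F (G.degree u) ≤
      Real.exp a + Real.exp b - Real.exp (a + b) * (F (G.degree u))⁻¹ := by
    intro u
    obtain ⟨h1, h2⟩ := hF u
    have hx := hpos u
    rw [Real.exp_add, ← sub_nonneg]
    have e : Real.exp a + Real.exp b - Real.exp a * Real.exp b * (F (G.degree u))⁻¹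
        - F (G.degree u) =
        (F (G.degree u) - Real.exp a) * (Real.exp b - F (G.degree u)) / F (G.degree u) := by
      field_simp
      ring
    rw [e]
    exact div_nonneg (mul_nonneg (sub_nonneg.2 h1) (sub_nonneg.2 h2)) hx.le
  have hsum := Finset.sum_le_sum (fun u (_ : u ∈ (Finset.univ : Finset V)) => hpt u)
  rw [Finset.sum_sub_distrib, ← Finset.mul_sum, Finset.sum_const, Finset.card_univ,
    nsmul_eq_mul] at hsum
  have hgm := Real.geom_mean_le_arith_mean_weighted (Finset.univ : Finset V)
    (fun _ => (1 : ℝ) / (Fintype.card V : ℝ)) (fun u => (F (G.degree u))⁻¹)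
    (fun _ _ => by positivity)
    (by rw [Finset.sum_const, Finset.card_univ, nsmul_eq_mul]; field_simp)
    (fun u _ => (inv_pos.2 (hpos u)).le)
  rw [Real.finsetProd_rpow _ _ (fun u _ => (inv_pos.2 (hpos u)).le), Finset.prod_inv_distrib,
    Real.inv_rpow (Finset.prod_nonneg fun u _ => (hpos u).le), ← Finset.mul_sum] at hgm
  have h3 := mul_le_mul_of_nonneg_left hgm (Real.exp_pos (a + b)).le
  have h4 := mul_le_mul_of_nonneg_left hsum (one_div_pos.2 hc).le
  have h5 : (1 / (Fintype.card V : ℝ)) * ((Fintype.card V : ℝ) * (Real.exp a + Real.exp b)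
      - Real.exp (a + b) * ∑ u : V, (F (G.degree u))⁻¹) = Real.exp a + Real.exp b -
      Real.exp (a + b) * (1 / (Fintype.card V : ℝ) * ∑ u : V, (F (G.degree u))⁻¹) := by
    field_simp
  rw [h5] at h4
  rw [div_eq_mul_inv (Real.exp (a + b))]
  linarith
end

section
/- Let G be a finite simple graph with m ≥ 1 edges, let a ≤ b be real numbers, and let F_E : ℕ × ℕ → ℝ be a symmetric function satisfying e^a ≤ F_E(d_u,d_v) ≤ e^b for every edge uv ∈ E(G). Then (1/m) · X_{Σ,F_E}(G) ≤ e^a + e^b − e^{a+b} / (X_{Π,F_E}(G))^{1/m}. -/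
/-- Abstract finite-set version. -/
theorem converse_jensen_aux {ι : Type*} (s : Finset ι) (hm : 1 ≤ s.card) (A B : ℝ) (hA : 0 < A)
    (f : ι → ℝ) (hf : ∀ i ∈ s, A ≤ f i ∧ f i ≤ B) (hAB : A ≤ B) :
    (1 / (s.card : ℝ)) * ∑ e ∈ s, f e ≤
      A + B - A * B / (∏ e ∈ s, f e) ^ ((1 : ℝ) / (s.card : ℝ)) := by
  have hc : (0 : ℝ) < s.card := by exact_mod_cast hm
  have hpos : ∀ i ∈ s, 0 < f i := fun i hi => lt_of_lt_of_le hA (hf i hi).1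
  have hpt : ∀ i ∈ s, f i ≤ A + B - A * B * (f i)⁻¹ := by
    intro i hi
    have h0 := hpos i hi
    obtain ⟨h1, h2⟩ := hf i hi
    rw [← div_eq_mul_inv, le_sub_iff_add_le, ← le_sub_iff_add_le', div_le_iff₀ h0]
    nlinarith [mul_nonneg (sub_nonneg.2 h1) (sub_nonneg.2 h2)]
  have hsum := Finset.sum_le_sum hpt
  rw [Finset.sum_sub_distrib, ← Finset.mul_sum, Finset.sum_const, nsmul_eq_mul] at hsum
  have hgm := Real.geom_mean_le_arith_mean_weighted s (fun _ => 1 / (s.card : ℝ))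
    (fun i => (f i)⁻¹) (fun i _ => by positivity)
    (by rw [Finset.sum_const, nsmul_eq_mul]; field_simp)
    (fun i hi => (inv_pos.2 (hpos i hi)).le)
  rw [Real.finsetProd_rpow s (fun i => (f i)⁻¹) (fun i hi => (inv_pos.2 (hpos i hi)).le),
    Finset.prod_inv_distrib, Real.inv_rpow (Finset.prod_nonneg fun i hi => (hpos i hi).le),
    ← Finset.mul_sum] at hgm
  have h1 := mul_le_mul_of_nonneg_left hgm (mul_pos hA (hA.trans_le hAB)).le
  have h2 := mul_le_mul_of_nonneg_left hsum (one_div_pos.2 hc).le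
  have h3 : 1 / (s.card : ℝ) * (s.card * (A + B) - A * B * ∑ i ∈ s, (f i)⁻¹) =
      A + B - A * B * (1 / (s.card : ℝ) * ∑ i ∈ s, (f i)⁻¹) := by
    field_simp
  rw [div_eq_mul_inv (A * B)]
  linarith

/-- Converse Jensen-type inequality (edge version): for a finite simple graph `G` with
`m ≥ 1` edges and a symmetric edge function `F_E` with `e^a ≤ F_E(d_u,d_v) ≤ e^b` on all
edges, `(1/m) · X_{Σ,F_E}(G) ≤ e^a + e^b − e^{a+b} / X_{Π,F_E}(G)^{1/m}`. -/
theorem converse_jensen_edge {V : Type*} [Fintype V] [DecidableEq V] (G : SimpleGraph V)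
    [DecidableRel G.Adj] (hm : 1 ≤ G.edgeFinset.card) (a b : ℝ) (hab : a ≤ b)
    (F : ℕ → ℕ → ℝ) (hsym : ∀ x y, F x y = F y x)
    (hF : ∀ u v : V, G.Adj u v →
      Real.exp a ≤ F (G.degree u) (G.degree v) ∧
        F (G.degree u) (G.degree v) ≤ Real.exp b) :
    (1 / (G.edgeFinset.card : ℝ)) *
        ∑ e ∈ G.edgeFinset,
          Sym2.lift ⟨fun u v => F (G.degree u) (G.degree v),
            fun u v => hsym (G.degree u) (G.degree v)⟩ e ≤
      Real.exp a + Real.exp b -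
        Real.exp (a + b) /
          (∏ e ∈ G.edgeFinset,
              Sym2.lift ⟨fun u v => F (G.degree u) (G.degree v),
                fun u v => hsym (G.degree u) (G.degree v)⟩ e) ^
            ((1 : ℝ) / (G.edgeFinset.card : ℝ)) := by
  rw [Real.exp_add]
  refine converse_jensen_aux G.edgeFinset hm _ _ (Real.exp_pos a) _ ?_ (Real.exp_le_exp.2 hab)
  intro e
  induction e using Sym2.ind with
  | _ u v =>
    intro he
    rw [SimpleGraph.mem_edgeFinset, SimpleGraph.mem_edgeSet] at he
    exact hF u v he
end

section
/- Let G be a finite simple graph with n ≥ 1 vertices and let F_V : ℕ → ℝ satisfy F_V(d_u) > 0 for every vertex u ∈ V(G). Then ∑_{u ∈ V(G)} F_V(d_u)² + n(n−1) · (X_{Π,F_V}(G))^{2/n} ≤ (X_{Σ,F_V}(G))² and (X_{Σ,F_V}(G))² ≤ (n−1) · ∑_{u ∈ V(G)} F_V(d_u)² + n · (X_{Π,F_V}(G))^{2/n}. -/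
lemma kober_tangent (u v : ℝ) : Real.exp v * (1 + u - v) ≤ Real.exp u := by
  have h := Real.add_one_le_exp (u - v)
  have h2 : Real.exp u = Real.exp v * Real.exp (u - v) := by
    rw [← Real.exp_add]; congr 1; ring
  rw [h2]
  exact mul_le_mul_of_nonneg_left (by linarith) (Real.exp_pos v).le

lemma kober_convex : ConvexOn ℝ (Set.Ici (0 : ℝ)) (fun t => (Real.exp t - 1) ^ 2) := by
  have h1 : ConvexOn ℝ (Set.Ici (0 : ℝ)) (fun t => Real.exp t - 1) :=
    (convexOn_exp.subset (Set.subset_univ _) (convex_Ici 0)).sub (concaveOn_const 1 (convex_Ici 0))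
  refine h1.pow ?_ 2
  intro t ht
  have : (0 : ℝ) ≤ t := ht
  have := Real.add_one_le_exp t
  show (0 : ℝ) ≤ Real.exp t - 1
  linarith

lemma kober_jensen {V : Type*} (s : Finset V) (a : V → ℝ) (b m : ℝ) (hs : (0 : ℝ) < s.card)
    (hm : (s.card : ℝ) * m = ∑ u ∈ s, a u) (hb : ∀ u ∈ s, b ≤ a u) :
    (s.card : ℝ) * (Real.exp m - Real.exp b) ^ 2 ≤
      ∑ u ∈ s, (Real.exp (a u) - Real.exp b) ^ 2 := by
  have hne : (s.card : ℝ) ≠ 0 := hs.ne'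
  have h := kober_convex.map_sum_le (t := s) (w := fun _ => (s.card : ℝ)⁻¹)
    (p := fun u => a u - b) (fun _ _ => by positivity)
    (by simp [hne]) (fun u hu => by
      show (0 : ℝ) ≤ a u - b
      linarith [hb u hu])
  simp only [smul_eq_mul, ← Finset.mul_sum] at h
  have e : (s.card : ℝ)⁻¹ * ∑ u ∈ s, (a u - b) = m - b := by
    rw [Finset.sum_sub_distrib, ← hm]
    simp
    field_simp
  rw [e] at h
  have key : ∀ t : ℝ, (Real.exp t - Real.exp b) ^ 2
      = Real.exp b ^ 2 * (Real.exp (t - b) - 1) ^ 2 := by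
    intro t
    have : Real.exp t = Real.exp b * Real.exp (t - b) := by
      rw [← Real.exp_add]; congr 1; ring
    rw [this]; ring
  simp only [key, ← Finset.mul_sum]
  have h3 : (s.card : ℝ) * (Real.exp (m - b) - 1) ^ 2 ≤ ∑ u ∈ s, (Real.exp (a u - b) - 1) ^ 2 := by
    have := mul_le_mul_of_nonneg_left h hs.le
    rwa [← mul_assoc, mul_inv_cancel₀ hne, one_mul] at this
  nlinarith [mul_le_mul_of_nonneg_left h3 (sq_nonneg (Real.exp b))]

lemma kober_upper {V : Type*} (s : Finset V) (a : V → ℝ) :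
    (∑ u ∈ s, Real.exp (a u)) ^ 2 ≤ ((s.card : ℝ) - 1) * ∑ u ∈ s, Real.exp (a u) ^ 2
      + s.card * Real.exp (2 / s.card * ∑ u ∈ s, a u) := by
  classical
  induction s using Finset.induction_on_min_value a with
  | empty => simp
  | insert i s hi hmin ih =>
    rcases s.eq_empty_or_nonempty with rfl | hne
    · simp [← Real.exp_nat_mul]
    have hs : (0 : ℝ) < s.card := by exact_mod_cast hne.card_pos
    have hs1 : (1 : ℝ) ≤ s.card := by exact_mod_cast hne.card_pos
    rw [Finset.sum_insert hi, Finset.sum_insert hi, Finset.sum_insert hi,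
      Finset.card_insert_of_notMem hi]
    push_cast
    obtain ⟨m, hm⟩ : ∃ m : ℝ, (s.card : ℝ) * m = ∑ u ∈ s, a u :=
      ⟨(∑ u ∈ s, a u) / s.card, by field_simp⟩
    have hj := kober_jensen s a (a i) m hs hm hmin
    rw [← hm] at ih ⊢
    have e1 : 2 / (s.card : ℝ) * (s.card * m) = m + m := by field_simp; ring
    rw [e1, Real.exp_add] at ih
    have e2 : ∑ u ∈ s, (Real.exp (a u) - Real.exp (a i)) ^ 2
        = ∑ u ∈ s, Real.exp (a u) ^ 2 - 2 * Real.exp (a i) * ∑ u ∈ s, Real.exp (a u)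
          + s.card * Real.exp (a i) ^ 2 := by
      simp only [sub_sq, Finset.sum_add_distrib, Finset.sum_sub_distrib, Finset.mul_sum,
        Finset.sum_const, nsmul_eq_mul]
      congr 2
      exact Finset.sum_congr rfl fun _ _ => by ring
    rw [e2] at hj
    set n : ℝ := (s.card : ℝ) with hn
    have t1 := kober_tangent (a i + a i) (m + a i)
    have t2 := kober_tangent (2 / (n + 1) * (a i + n * m)) (m + a i)
    have t3 : (n - 1) * (1 + (a i + a i) - (m + a i))
      + (n + 1) * (1 + (2 / (n + 1) * (a i + n * m)) - (m + a i)) = 2 * n := by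
      field_simp; ring
    have t1' := mul_le_mul_of_nonneg_left t1 (by linarith : 0 ≤ n - 1)
    have t2' := mul_le_mul_of_nonneg_left t2 (by linarith : 0 ≤ n + 1)
    have t4 : 2 * n * Real.exp (m + a i) ≤ (n - 1) * Real.exp (a i + a i)
      + (n + 1) * Real.exp (2 / (n + 1) * (a i + n * m)) := by
      rw [← t3]; linarith
    rw [Real.exp_add, Real.exp_add] at t4
    linarith

lemma kober_lower {V : Type*} (s : Finset V) (a : V → ℝ) (hs : (0 : ℝ) < s.card) :
    (∑ u ∈ s, Real.exp (a u) ^ 2) + s.card * ((s.card : ℝ) - 1) *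
      Real.exp (2 / s.card * ∑ u ∈ s, a u) ≤ (∑ u ∈ s, Real.exp (a u)) ^ 2 := by
  obtain ⟨m, hm⟩ : ∃ m : ℝ, (s.card : ℝ) * m = ∑ u ∈ s, a u :=
    ⟨(∑ u ∈ s, a u) / s.card, by field_simp⟩
  have e1 : 2 / (s.card : ℝ) * (s.card * m) = 2 * m := by field_simp
  rw [← hm, e1]
  set g := Real.exp (2 * m) with hg
  have h : ∑ u ∈ s, (Real.exp (a u) * Real.exp (a u) - g * (1 + (a u + a u) - 2 * m)) ≤
      ∑ u ∈ s, ∑ v ∈ s, (Real.exp (a u) * Real.exp (a v) - g * (1 + (a u + a v) - 2 * m)) := by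
    refine Finset.sum_le_sum fun u hu => ?_
    refine Finset.single_le_sum
      (f := fun v => Real.exp (a u) * Real.exp (a v) - g * (1 + (a u + a v) - 2 * m)) ?_ hu
    intro v _
    have := kober_tangent (a u + a v) (2 * m)
    rw [Real.exp_add] at this
    exact sub_nonneg.2 this
  simp only [Finset.sum_sub_distrib, ← Finset.mul_sum, ← Finset.sum_mul, Finset.sum_add_distrib,
    Finset.sum_const, nsmul_eq_mul, ← hm, ← pow_two] at h
  linarith



/-- Kober-type inequalities for vertex-based topological indices: if `G` has `n ≥ 1`
vertices and `F_V(d_u) > 0` for all vertices `u`, then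
`X_{Σ,F_V²}(G) + n(n−1)·X_{Π,F_V}(G)^{2/n} ≤ X_{Σ,F_V}(G)²` and
`X_{Σ,F_V}(G)² ≤ (n−1)·X_{Σ,F_V²}(G) + n·X_{Π,F_V}(G)^{2/n}`. -/
theorem kober_vertex {V : Type*} [Fintype V] (G : SimpleGraph V) [DecidableRel G.Adj]
    (hn : 1 ≤ Fintype.card V) (F : ℕ → ℝ) (hF : ∀ u : V, 0 < F (G.degree u)) :
    (∑ u : V, F (G.degree u) ^ 2) +
        (Fintype.card V : ℝ) * ((Fintype.card V : ℝ) - 1) *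
          (∏ u : V, F (G.degree u)) ^ ((2 : ℝ) / (Fintype.card V : ℝ)) ≤
      (∑ u : V, F (G.degree u)) ^ 2 ∧
    (∑ u : V, F (G.degree u)) ^ 2 ≤
      ((Fintype.card V : ℝ) - 1) * (∑ u : V, F (G.degree u) ^ 2) +
        (Fintype.card V : ℝ) *
          (∏ u : V, F (G.degree u)) ^ ((2 : ℝ) / (Fintype.card V : ℝ)) := by

  have hx : ∀ u : V, F (G.degree u) = Real.exp (Real.log (F (G.degree u))) :=
    fun u => (Real.exp_log (hF u)).symm
  have hp : (∏ u : V, F (G.degree u)) ^ ((2 : ℝ) / (Fintype.card V : ℝ))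
      = Real.exp (2 / (Fintype.card V : ℝ) * ∑ u : V, Real.log (F (G.degree u))) := by
    rw [Real.rpow_def_of_pos (Finset.prod_pos fun u _ => hF u),
      Real.log_prod (fun u _ => (hF u).ne'), mul_comm]
  have hc : (0 : ℝ) < (Finset.univ : Finset V).card := by
    rw [Finset.card_univ]; exact_mod_cast hn
  have h1 := kober_lower Finset.univ (fun u : V => Real.log (F (G.degree u))) hc
  have h2 := kober_upper Finset.univ (fun u : V => Real.log (F (G.degree u)))
  simp only [← hx, Finset.card_univ] at h1 h2
  rw [hp]
  exact ⟨h1, h2⟩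
end

section
/- Let G be a finite simple graph with m ≥ 1 edges and let F_E : ℕ × ℕ → ℝ be a symmetric function satisfying F_E(d_u,d_v) > 0 for every edge uv ∈ E(G). Then ∑_{uv ∈ E(G)} F_E(d_u,d_v)² + m(m−1) · (X_{Π,F_E}(G))^{2/m} ≤ (X_{Σ,F_E}(G))² and (X_{Σ,F_E}(G))² ≤ (m−1) · ∑_{uv ∈ E(G)} F_E(d_u,d_v)² + m · (X_{Π,F_E}(G))^{2/m}. -/
open Finset in
lemma kober_aux_lower {ι : Type*} (s : Finset ι) (f : ι → ℝ) (hf : ∀ i ∈ s, 0 < f i)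
    (l : ℝ) (hl : (s.card : ℝ) * l = ∑ i ∈ s, Real.log (f i)) :
    ∑ i ∈ s, f i ^ 2 + (s.card : ℝ) * ((s.card : ℝ) - 1) * Real.exp (2 * l)
      ≤ (∑ i ∈ s, f i) ^ 2 := by
  set c : ι → ι → ℝ := fun i j =>
    f i * f j - Real.exp (2 * l) * (1 + (Real.log (f i) - l) + (Real.log (f j) - l)) with hc
  have hc0 : ∀ i ∈ s, ∀ j ∈ s, 0 ≤ c i j := by
    intro i hi j hj
    have h1 : f i * f j
        = Real.exp (2 * l) * Real.exp ((Real.log (f i) - l) + (Real.log (f j) - l)) := by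
      rw [← Real.exp_add, show 2 * l + ((Real.log (f i) - l) + (Real.log (f j) - l))
        = Real.log (f i) + Real.log (f j) by ring, Real.exp_add, Real.exp_log (hf i hi),
        Real.exp_log (hf j hj)]
    have h2 := Real.add_one_le_exp ((Real.log (f i) - l) + (Real.log (f j) - l))
    simp only [hc]
    rw [h1]
    have := mul_le_mul_of_nonneg_left h2 (Real.exp_pos (2 * l)).le
    linarith
  have h1 : ∑ i ∈ s, c i i ≤ ∑ i ∈ s, ∑ j ∈ s, c i j :=
    Finset.sum_le_sum fun i hi => Finset.single_le_sum (f := fun j => c i j) (hc0 i hi) hi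
  have h2 : ∑ i ∈ s, c i i = ∑ i ∈ s, f i ^ 2 - Real.exp (2 * l) * s.card := by
    simp only [hc, Finset.sum_sub_distrib, ← Finset.mul_sum, Finset.sum_add_distrib,
      Finset.sum_const, nsmul_eq_mul, ← hl, ← pow_two]
    ring
  have h3 : ∑ i ∈ s, ∑ j ∈ s, c i j
      = (∑ i ∈ s, f i) ^ 2 - Real.exp (2 * l) * (s.card : ℝ) ^ 2 := by
    simp only [hc, Finset.sum_sub_distrib, ← Finset.mul_sum, Finset.sum_add_distrib,
      Finset.sum_const, nsmul_eq_mul, ← hl, ← Finset.sum_mul]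
    ring
  rw [h2, h3] at h1
  linarith

open Finset in
lemma kober_aux_upper {ι : Type*} [DecidableEq ι] (s : Finset ι) (f : ι → ℝ) :
    (∀ i ∈ s, 0 < f i) → ∀ l : ℝ, (s.card : ℝ) * l = ∑ i ∈ s, Real.log (f i) →
    (∑ i ∈ s, f i) ^ 2 ≤
      ((s.card : ℝ) - 1) * ∑ i ∈ s, f i ^ 2 + (s.card : ℝ) * Real.exp l ^ 2 := by
  induction s using Finset.induction_on_min_value f with
  | empty => intro _ l _; simp
  | insert a s ha hmin ih =>
    intro hf h hh
    have hfs : ∀ i ∈ s, 0 < f i := fun i hi => hf i (Finset.mem_insert_of_mem hi)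
    have hfa : 0 < f a := hf a (Finset.mem_insert_self _ _)
    rw [Finset.card_insert_of_notMem ha, Finset.sum_insert ha] at hh
    rw [Finset.card_insert_of_notMem ha, Finset.sum_insert ha, Finset.sum_insert ha]
    push_cast at hh ⊢
    rcases s.eq_empty_or_nonempty with rfl | hne
    · simp at hh ⊢
      rw [hh, Real.exp_log hfa]
    have hn : (1 : ℝ) ≤ s.card := by exact_mod_cast hne.card_pos
    set n : ℝ := (s.card : ℝ) with hndef
    set t := f a with ht
    set l : ℝ := (∑ i ∈ s, Real.log (f i)) / n with hl
    have hl' : n * l = ∑ i ∈ s, Real.log (f i) := by rw [hl]; field_simp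
    have IH := ih hfs l hl'
    rw [← hl'] at hh
    have hcs : (∑ i ∈ s, f i) ^ 2 ≤ n * ∑ i ∈ s, f i ^ 2 := sq_sum_le_card_mul_sum_sq
    have hS : n * Real.exp l ≤ ∑ i ∈ s, f i := by
      have : ∑ i ∈ s, Real.exp l * (1 + (Real.log (f i) - l)) ≤ ∑ i ∈ s, f i := by
        refine Finset.sum_le_sum fun i hi => ?_
        have h2 := Real.add_one_le_exp (Real.log (f i) - l)
        have h3 := mul_le_mul_of_nonneg_left h2 (Real.exp_pos l).le
        rw [← Real.exp_add, add_sub_cancel, Real.exp_log (hfs i hi)] at h3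
        linarith
      simp only [← Finset.mul_sum, Finset.sum_add_distrib, Finset.sum_sub_distrib,
        Finset.sum_const, nsmul_eq_mul, ← hl', ← hndef] at this
      linarith
    have hlt : Real.log t ≤ l := by
      have : n * Real.log t ≤ n * l := by
        rw [hl', hndef, ← nsmul_eq_mul]
        exact Finset.card_nsmul_le_sum _ _ _ fun i hi => Real.log_le_log hfa (hmin i hi)
      exact le_of_mul_le_mul_left this (by linarith)
    have htg : t ≤ Real.exp l := by
      rw [← Real.exp_log hfa]; exact Real.exp_le_exp.2 hlt
    have ham : 2 * n * (Real.exp l * t) ≤ (n - 1) * t ^ 2 + (n + 1) * Real.exp h ^ 2 := by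
      have e1 : t ^ 2 = (Real.exp l * t) * Real.exp (Real.log t - l) := by
        rw [Real.exp_sub, Real.exp_log hfa]; field_simp
      have e2 : Real.exp h ^ 2 = (Real.exp l * t) * Real.exp (2 * h - l - Real.log t) := by
        rw [Real.exp_sub, Real.exp_sub, Real.exp_log hfa, two_mul, Real.exp_add]; field_simp
      have p : 0 < Real.exp l * t := mul_pos (Real.exp_pos _) hfa
      have i1 := mul_le_mul_of_nonneg_left (Real.add_one_le_exp (Real.log t - l))
        (by linarith : 0 ≤ n - 1)
      have i2 := mul_le_mul_of_nonneg_left (Real.add_one_le_exp (2 * h - l - Real.log t))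
        (by linarith : 0 ≤ n + 1)
      have i3 : 2 * n ≤ (n - 1) * Real.exp (Real.log t - l)
          + (n + 1) * Real.exp (2 * h - l - Real.log t) := by linarith
      rw [e1, e2]
      have := mul_le_mul_of_nonneg_left i3 p.le
      linarith
    clear_value n l t
    generalize Real.exp l = g at *
    generalize Real.exp h = k at *
    generalize ∑ i ∈ s, f i ^ 2 = Q at *
    generalize ∑ i ∈ s, f i = S at *
    have key : n * g ^ 2 - 2 * n * g * t ≤ Q - 2 * S * t := by
      have h1 : (n * g - n * t) ^ 2 ≤ (S - n * t) ^ 2 := by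
        have : 0 ≤ n * g - n * t := by nlinarith
        exact pow_le_pow_left₀ this (by linarith) 2
      have h2 : n * (n * g ^ 2 - 2 * n * g * t) ≤ n * (Q - 2 * S * t) := by nlinarith
      exact le_of_mul_le_mul_left h2 (by linarith)
    nlinarith

/-- Kober-type inequalities for edge-based topological indices: if `G` has `m ≥ 1`
edges and the symmetric function `F_E` satisfies `F_E(d_u,d_v) > 0` on all edges, then
`X_{Σ,F_E²}(G) + m(m−1)·X_{Π,F_E}(G)^{2/m} ≤ X_{Σ,F_E}(G)²` and
`X_{Σ,F_E}(G)² ≤ (m−1)·X_{Σ,F_E²}(G) + m·X_{Π,F_E}(G)^{2/m}`. -/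
theorem kober_edge {V : Type*} [Fintype V] [DecidableEq V] (G : SimpleGraph V)
    [DecidableRel G.Adj] (hm : 1 ≤ G.edgeFinset.card)
    (F : ℕ → ℕ → ℝ) (hsym : ∀ x y, F x y = F y x)
    (hF : ∀ u v : V, G.Adj u v → 0 < F (G.degree u) (G.degree v)) :
    (∑ e ∈ G.edgeFinset,
          (Sym2.lift ⟨fun u v => F (G.degree u) (G.degree v),
            fun u v => hsym (G.degree u) (G.degree v)⟩ e) ^ 2) +
        (G.edgeFinset.card : ℝ) * ((G.edgeFinset.card : ℝ) - 1) *
          (∏ e ∈ G.edgeFinset,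
              Sym2.lift ⟨fun u v => F (G.degree u) (G.degree v),
                fun u v => hsym (G.degree u) (G.degree v)⟩ e) ^
            ((2 : ℝ) / (G.edgeFinset.card : ℝ)) ≤
      (∑ e ∈ G.edgeFinset,
          Sym2.lift ⟨fun u v => F (G.degree u) (G.degree v),
            fun u v => hsym (G.degree u) (G.degree v)⟩ e) ^ 2 ∧
    (∑ e ∈ G.edgeFinset,
        Sym2.lift ⟨fun u v => F (G.degree u) (G.degree v),
          fun u v => hsym (G.degree u) (G.degree v)⟩ e) ^ 2 ≤
      ((G.edgeFinset.card : ℝ) - 1) *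
          (∑ e ∈ G.edgeFinset,
            (Sym2.lift ⟨fun u v => F (G.degree u) (G.degree v),
              fun u v => hsym (G.degree u) (G.degree v)⟩ e) ^ 2) +
        (G.edgeFinset.card : ℝ) *
          (∏ e ∈ G.edgeFinset,
              Sym2.lift ⟨fun u v => F (G.degree u) (G.degree v),
                fun u v => hsym (G.degree u) (G.degree v)⟩ e) ^
            ((2 : ℝ) / (G.edgeFinset.card : ℝ)) := by
  set f : Sym2 V → ℝ := Sym2.lift ⟨fun u v => F (G.degree u) (G.degree v),
    fun u v => hsym (G.degree u) (G.degree v)⟩ with hfdef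
  have hf : ∀ e ∈ G.edgeFinset, 0 < f e := by
    intro e
    induction e using Sym2.ind with
    | _ u v =>
      intro he
      exact hF u v (by simpa using he)
  have hm0 : (G.edgeFinset.card : ℝ) ≠ 0 := by
    have : G.edgeFinset.card ≠ 0 := by omega
    exact_mod_cast this
  set l : ℝ := (∑ e ∈ G.edgeFinset, Real.log (f e)) / (G.edgeFinset.card : ℝ) with hl
  have hl' : (G.edgeFinset.card : ℝ) * l = ∑ e ∈ G.edgeFinset, Real.log (f e) := by
    rw [hl]; field_simp
  have hP : (∏ e ∈ G.edgeFinset, f e) ^ ((2 : ℝ) / (G.edgeFinset.card : ℝ))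
      = Real.exp (2 * l) := by
    rw [Real.rpow_def_of_pos (Finset.prod_pos hf), Real.log_prod fun e he => (hf e he).ne', hl]
    congr 1
    ring
  rw [hP]
  refine ⟨kober_aux_lower _ f hf l hl', ?_⟩
  have := kober_aux_upper _ f hf l hl'
  rwa [show Real.exp l ^ 2 = Real.exp (2 * l) by rw [two_mul, Real.exp_add, sq]] at this
end

section
/- Let G be a finite simple graph with n vertices and let F_V : ℕ → ℝ satisfy F_V(d_u) ≥ 1 for every vertex u ∈ V(G). Then X_{Σ,F_V}(G) ≤ X_{Π,F_V}(G) + n − 1. -/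
theorem petrovic_aux {V : Type*} (f : V → ℝ) (hf : ∀ u, 1 ≤ f u) (s : Finset V) :
    1 ≤ ∏ u ∈ s, f u ∧ ∑ u ∈ s, f u ≤ (∏ u ∈ s, f u) + (s.card : ℝ) - 1 := by
  classical
  induction s using Finset.induction_on with
  | empty => simp
  | insert a s ha ih =>
    obtain ⟨h1, h2⟩ := ih
    rw [Finset.sum_insert ha, Finset.prod_insert ha, Finset.card_insert_of_notMem ha]
    have h := hf a
    push_cast
    constructor <;> nlinarith [mul_nonneg (sub_nonneg.2 h) (sub_nonneg.2 h1)]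

/-- Petrović-type inequality (vertex version): if `G` has `n` vertices and
`F_V(d_u) ≥ 1` for every vertex `u`, then `X_{Σ,F_V}(G) ≤ X_{Π,F_V}(G) + n − 1`. -/
theorem petrovic_vertex {V : Type*} [Fintype V] (G : SimpleGraph V) [DecidableRel G.Adj]
    (F : ℕ → ℝ) (hF : ∀ u : V, 1 ≤ F (G.degree u)) :
    ∑ u : V, F (G.degree u) ≤
      (∏ u : V, F (G.degree u)) + (Fintype.card V : ℝ) - 1 := by
  exact (petrovic_aux (fun u => F (G.degree u)) hF Finset.univ).2
end

section
/- Let μ be a probability measure on a measurable space X, let a ≤ b be real constants, let f : X → ℝ be a measurable function with a ≤ f(x) ≤ b for all x ∈ X, and let φ : ℝ → ℝ be continuous and convex on [a,b]. Then φ(a + b − ∫_X f dμ) ≤ φ(a) + φ(b) − ∫_X (φ ∘ f) dμ. -/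
open MeasureTheory

theorem jensen_type_integrable {X : Type*} [MeasurableSpace X] (μ : Measure X)
    [IsProbabilityMeasure μ] (a b : ℝ) (g : X → ℝ)
    (hg : Measurable g) (hgab : ∀ x, g x ∈ Set.Icc a b)
    (φ : ℝ → ℝ) (hφc : ContinuousOn φ (Set.Icc a b)) :
    Integrable (fun x => φ (g x)) μ := by
  obtain ⟨C, hC⟩ := isCompact_Icc.exists_bound_of_continuousOn hφc
  have hm : Measurable (fun x => φ (g x)) :=
    (continuousOn_iff_continuous_restrict.1 hφc).measurable.comp (hg.subtype_mk (h := hgab))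
  exact Integrable.of_bound hm.aestronglyMeasurable C
    (Filter.Eventually.of_forall fun x => hC _ (hgab x))

theorem jensen_type_pointwise (a b : ℝ) (φ : ℝ → ℝ) (hab : a ≤ b)
    (hφ : ConvexOn ℝ (Set.Icc a b) φ) (y : ℝ) (hy : y ∈ Set.Icc a b) :
    φ (a + b - y) ≤ φ a + φ b - φ y := by
  have ha : a ∈ Set.Icc a b := ⟨le_rfl, hab⟩
  have hb : b ∈ Set.Icc a b := ⟨hab, le_rfl⟩
  rw [← segment_eq_Icc hab] at hy
  obtain ⟨s, t, hs, ht, hst, rfl⟩ := hy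
  have h1 := hφ.2 ha hb hs ht hst
  have h2 := hφ.2 ha hb ht hs (by linarith)
  simp only [smul_eq_mul] at *
  have e : a + b - (s * a + t * b) = t * a + s * b := by
    have : t = 1 - s := by linarith
    subst this; ring
  rw [e]
  have e2 : φ a + φ b = (s + t) * φ a + (s + t) * φ b := by rw [hst]; ring
  linarith

/-- Jensen-type inequality: if `μ` is a probability measure on `X`, `a ≤ b`,
`f : X → ℝ` is measurable with `a ≤ f x ≤ b` for all `x`, and `φ` is continuous and
convex on `[a,b]`, then `φ(a + b − ∫ f dμ) ≤ φ(a) + φ(b) − ∫ φ ∘ f dμ`. -/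
theorem jensen_type {X : Type*} [MeasurableSpace X] (μ : Measure X)
    [IsProbabilityMeasure μ] (a b : ℝ) (hab : a ≤ b) (f : X → ℝ)
    (hf : Measurable f) (hfab : ∀ x, f x ∈ Set.Icc a b)
    (φ : ℝ → ℝ) (hφc : ContinuousOn φ (Set.Icc a b))
    (hφ : ConvexOn ℝ (Set.Icc a b) φ) :
    φ (a + b - ∫ x, f x ∂μ) ≤ φ a + φ b - ∫ x, φ (f x) ∂μ := by
  have hmem : ∀ x, a + b - f x ∈ Set.Icc a b := fun x =>
    ⟨by linarith [(hfab x).2], by linarith [(hfab x).1]⟩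
  have hfi : Integrable f μ := jensen_type_integrable μ a b f hf hfab id continuousOn_id
  have h1 := jensen_type_integrable μ a b f hf hfab φ hφc
  have h2 := jensen_type_integrable μ a b (fun x => a + b - f x) (by fun_prop) hmem φ hφc
  have hJ := hφ.map_integral_le hφc isClosed_Icc (Filter.Eventually.of_forall hmem)
    ((integrable_const (a + b)).sub hfi) h2
  have hI : ∫ x, (a + b - f x) ∂μ = a + b - ∫ x, f x ∂μ := by
    rw [integral_sub (integrable_const _) hfi]; simp
  have hM : ∫ x, φ (a + b - f x) ∂μ ≤ ∫ x, (φ a + φ b - φ (f x)) ∂μ :=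
    integral_mono h2 ((integrable_const _).sub h1)
      fun x => jensen_type_pointwise a b φ hab hφ _ (hfab x)
  have hK : ∫ x, (φ a + φ b - φ (f x)) ∂μ = φ a + φ b - ∫ x, φ (f x) ∂μ := by
    rw [integral_sub (integrable_const _) h1]; simp
  rw [hI] at hJ
  linarith
end

section
/- If a_1, …, a_k are positive real numbers, then ∑_{j=1}^k a_j + k(k−1) · (∏_{j=1}^k a_j)^{1/k} ≤ (∑_{j=1}^k √(a_j))² and (∑_{j=1}^k √(a_j))² ≤ (k−1) · ∑_{j=1}^k a_j + k · (∏_{j=1}^k a_j)^{1/k}. -/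
lemma kober_aux (x M : ℝ) (hx : 0 < x) :
    Real.exp M * (1 + Real.log x - M) ≤ x := by
  have h := Real.add_one_le_exp (Real.log x - M)
  rw [Real.exp_sub, Real.exp_log hx] at h
  have hp := Real.exp_pos M
  rw [le_div_iff₀ hp] at h
  linarith

lemma kober_amgm {ι : Type*} (s : Finset ι) (x : ι → ℝ) (hx : ∀ i, 0 < x i) (L : ℝ)
    (hL : ∑ i ∈ s, Real.log (x i) = s.card * L) :
    s.card * Real.exp L ≤ ∑ i ∈ s, x i := by
  have h := Finset.sum_le_sum (fun i (_ : i ∈ s) => kober_aux (x i) L (hx i))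
  rw [← Finset.mul_sum, Finset.sum_sub_distrib, Finset.sum_add_distrib, hL] at h
  simp at h
  linarith

lemma kober_upper_s11 {ι : Type*} [DecidableEq ι] (x : ι → ℝ) (hx : ∀ i, 0 < x i) (s : Finset ι) :
    ∀ L : ℝ, ∑ i ∈ s, Real.log (x i) = s.card * L →
    (∑ i ∈ s, x i) ^ 2 ≤ ((s.card : ℝ) - 1) * ∑ i ∈ s, x i ^ 2 + s.card * Real.exp (2 * L) := by
  induction s using Finset.induction_on_min_value x with
  | empty => simp
  | insert a s has hmin ih =>
    intro M hM
    rcases s.eq_empty_or_nonempty with rfl | hs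
    · simp at hM ⊢
      rw [← hM, two_mul, Real.exp_add, Real.exp_log (hx a), sq]
    have hn : (0 : ℝ) < s.card := by exact_mod_cast hs.card_pos
    have hn1 : (1 : ℝ) ≤ s.card := by exact_mod_cast hs.card_pos
    rw [Finset.sum_insert has] at hM
    rw [Finset.sum_insert has, Finset.sum_insert has]
    rw [Finset.card_insert_of_notMem has] at hM ⊢
    push_cast at hM ⊢
    obtain ⟨L, hL⟩ : ∃ L, ∑ i ∈ s, Real.log (x i) = s.card * L :=
      ⟨(∑ i ∈ s, Real.log (x i)) / s.card, by field_simp⟩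
    have ih := ih L hL
    have hA := kober_amgm s x hx L hL
    have hCS : (∑ i ∈ s, x i) ^ 2 ≤ s.card * ∑ i ∈ s, x i ^ 2 := sq_sum_le_card_mul_sum_sq
    have hy := hx a
    have hSy : s.card * x a ≤ ∑ i ∈ s, x i := by
      simpa using Finset.card_nsmul_le_sum s x (x a) hmin
    have hGy : x a ≤ Real.exp L := by
      rw [← Real.log_le_iff_le_exp hy]
      have : s.card * Real.log (x a) ≤ ∑ i ∈ s, Real.log (x i) := by
        simpa using Finset.card_nsmul_le_sum s (fun i => Real.log (x i)) (Real.log (x a))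
          (fun i hi => Real.log_le_log hy (hmin i hi))
      rw [hL] at this
      exact le_of_mul_le_mul_left this hn
    rw [hL] at hM
    have h1 := kober_aux (Real.exp (2 * M)) (L + Real.log (x a)) (Real.exp_pos _)
    have h2 := kober_aux (x a ^ 2) (L + Real.log (x a)) (by positivity)
    rw [Real.log_exp] at h1
    rw [Real.log_pow] at h2
    rw [Real.exp_add, Real.exp_log hy] at h1 h2
    have hG2 : Real.exp (2 * L) = Real.exp L ^ 2 := by rw [two_mul, Real.exp_add, sq]
    rw [hG2] at ih
    generalize Real.exp (2 * M) = H at *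
    generalize Real.exp L = G at *
    generalize Real.log (x a) = l at *
    generalize x a = y at *
    generalize (∑ i ∈ s, x i ^ 2) = Q at *
    generalize (∑ i ∈ s, x i) = S at *
    generalize (s.card : ℝ) = n at *
    push_cast at h2
    have h3 : 2 * n * (G * y) ≤ (n + 1) * H + (n - 1) * y ^ 2 := by
      have e1 := mul_le_mul_of_nonneg_left h1 (by linarith : 0 ≤ n + 1)
      have e2 := mul_le_mul_of_nonneg_left h2 (by linarith : 0 ≤ n - 1)
      have : (n + 1) * (G * y * (1 + 2 * M - (L + l))) + (n - 1) * (G * y * (1 + 2 * l - (L + l)))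
          = 2 * n * (G * y) := by
        linear_combination (-2 * G * y) * hM
      linarith
    have h4 : n * G ^ 2 - 2 * n * G * y ≤ Q - 2 * y * S := by
      refine le_of_mul_le_mul_left ?_ hn
      have : 0 ≤ (S - n * G) * ((S - n * y) + n * (G - y)) :=
        mul_nonneg (by linarith) (add_nonneg (by linarith) (mul_nonneg hn.le (by linarith)))
      nlinarith
    nlinarith

lemma kober_lower_s11 {k : ℕ} (x : Fin k → ℝ) (hx : ∀ i, 0 < x i) (L : ℝ)
    (hL : ∑ i, Real.log (x i) = k * L) :
    ∑ i, x i ^ 2 + k * ((k : ℝ) - 1) * Real.exp (2 * L) ≤ (∑ i, x i) ^ 2 := by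
  set g := Real.exp (2 * L)
  let f : Fin k → Fin k → ℝ :=
    fun i j => x i * x j - g * (1 + (Real.log (x i) + Real.log (x j)) - 2 * L)
  have hf : ∀ i j, 0 ≤ f i j := by
    intro i j
    have := kober_aux (x i * x j) (2 * L) (mul_pos (hx i) (hx j))
    rw [Real.log_mul (hx i).ne' (hx j).ne'] at this
    exact sub_nonneg.2 this
  have h1 : ∑ i, f i i ≤ ∑ i, ∑ j, f i j :=
    Finset.sum_le_sum fun i _ =>
      Finset.single_le_sum (f := fun j => f i j) (fun j _ => hf i j) (Finset.mem_univ i)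
  have h2 : ∑ i, f i i = ∑ i, x i ^ 2 - k * g := by
    simp only [f, Finset.sum_sub_distrib, ← Finset.mul_sum, Finset.sum_add_distrib, hL, sq]
    simp
    ring_nf
  have h3 : ∑ i, ∑ j, f i j = (∑ i, x i) ^ 2 - k ^ 2 * g := by
    simp only [f, Finset.sum_sub_distrib, ← Finset.mul_sum, Finset.sum_add_distrib, hL, sq,
      ← Finset.sum_mul, Finset.sum_const, Finset.card_univ, Fintype.card_fin, nsmul_eq_mul]
    ring
  rw [h2, h3] at h1
  linarith


/-- Kober's inequalities: for positive reals `a 1, …, a k` (with `k ≥ 1`),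
`∑ a j + k(k−1)·(∏ a j)^{1/k} ≤ (∑ √(a j))²` and
`(∑ √(a j))² ≤ (k−1)·∑ a j + k·(∏ a j)^{1/k}`. -/
theorem kober {k : ℕ} (hk : 1 ≤ k) (a : Fin k → ℝ) (ha : ∀ j, 0 < a j) :
    (∑ j, a j) + (k : ℝ) * ((k : ℝ) - 1) * (∏ j, a j) ^ ((1 : ℝ) / (k : ℝ)) ≤
        (∑ j, Real.sqrt (a j)) ^ 2 ∧
      (∑ j, Real.sqrt (a j)) ^ 2 ≤
        ((k : ℝ) - 1) * (∑ j, a j) + (k : ℝ) * (∏ j, a j) ^ ((1 : ℝ) / (k : ℝ)) := by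
  have hk0 : (0 : ℝ) < k := by exact_mod_cast hk
  have hx : ∀ i, 0 < Real.sqrt (a i) := fun i => Real.sqrt_pos.2 (ha i)
  have hsq : ∀ i, Real.sqrt (a i) ^ 2 = a i := fun i => Real.sq_sqrt (ha i).le
  obtain ⟨L, hL⟩ : ∃ L, ∑ i, Real.log (Real.sqrt (a i)) = k * L :=
    ⟨(∑ i, Real.log (Real.sqrt (a i))) / k, by field_simp⟩
  have hg : (∏ j, a j) ^ ((1 : ℝ) / (k : ℝ)) = Real.exp (2 * L) := by
    rw [Real.rpow_def_of_pos (Finset.prod_pos fun i _ => ha i),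
      Real.log_prod (fun i _ => (ha i).ne')]
    congr 1
    have : ∀ i, Real.log (Real.sqrt (a i)) = Real.log (a i) / 2 := fun i =>
      Real.log_sqrt (ha i).le
    simp only [this, ← Finset.sum_div] at hL
    field_simp
    linarith
  have h1 := kober_lower_s11 (fun i => Real.sqrt (a i)) hx L hL
  have h2 := kober_upper_s11 (fun i => Real.sqrt (a i)) hx Finset.univ L (by simpa using hL)
  simp only [hsq, Finset.card_univ, Fintype.card_fin] at h1 h2
  rw [hg]
  exact ⟨h1, h2⟩
end

section
/- Let a > 0, let φ : ℝ → ℝ be convex on [0,a], let w_1, …, w_n ≥ 0 and t_1, …, t_n ∈ [0,a] be real numbers such that 0 < ∑_{k=1}^n t_k w_k ≤ a and ∑_{k=1}^n t_k w_k ≥ t_j for every j = 1, …, n. Then ∑_{k=1}^n φ(t_k) w_k ≤ φ(∑_{k=1}^n t_k w_k) + (∑_{k=1}^n w_k − 1) · φ(0). -/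
/-- Petrović's inequality: let `a > 0`, `φ` convex on `[0,a]`, weights `w j ≥ 0` and
points `t j ∈ [0,a]` with `0 < ∑ t j * w j ≤ a` and `∑ t j * w j ≥ t i` for every `i`.
Then `∑ φ(t j) * w j ≤ φ(∑ t j * w j) + (∑ w j − 1)·φ(0)`. -/
theorem petrovic_weighted {a : ℝ} (ha : 0 < a) (φ : ℝ → ℝ)
    (hφ : ConvexOn ℝ (Set.Icc 0 a) φ) {n : ℕ} (w t : Fin n → ℝ)
    (hw : ∀ j, 0 ≤ w j) (ht : ∀ j, t j ∈ Set.Icc 0 a)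
    (hsum_pos : 0 < ∑ j, t j * w j) (hsum_le : ∑ j, t j * w j ≤ a)
    (hmaj : ∀ j, t j ≤ ∑ i, t i * w i) :
    ∑ j, φ (t j) * w j ≤ φ (∑ j, t j * w j) + ((∑ j, w j) - 1) * φ 0 := by
  obtain ⟨S, hS⟩ : ∃ S, S = ∑ j, t j * w j := ⟨_, rfl⟩
  rw [← hS] at hsum_pos hsum_le hmaj ⊢
  have key : ∀ j, φ (t j) * w j ≤ (t j * w j) * ((φ S - φ 0) / S) + w j * φ 0 := by
    intro j
    have h1 : t j / S ≤ 1 := (div_le_one hsum_pos).2 (hmaj j)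
    have h2 : 0 ≤ t j / S := div_nonneg (ht j).1 hsum_pos.le
    have h := hφ.2 (⟨hsum_pos.le, hsum_le⟩ : S ∈ Set.Icc 0 a)
      (⟨le_refl _, ha.le⟩ : (0 : ℝ) ∈ Set.Icc 0 a) h2 (sub_nonneg.2 h1) (by ring)
    simp only [smul_eq_mul, mul_zero, add_zero] at h
    rw [div_mul_cancel₀ _ hsum_pos.ne'] at h
    calc φ (t j) * w j ≤ (t j / S * φ S + (1 - t j / S) * φ 0) * w j :=
          mul_le_mul_of_nonneg_right h (hw j)
      _ = _ := by ring
  calc ∑ j, φ (t j) * w j ≤ ∑ j, ((t j * w j) * ((φ S - φ 0) / S) + w j * φ 0) :=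
        Finset.sum_le_sum fun j _ => key j
    _ = S * ((φ S - φ 0) / S) + (∑ j, w j) * φ 0 := by
        rw [Finset.sum_add_distrib, ← Finset.sum_mul, ← Finset.sum_mul, ← hS]
    _ = φ S + ((∑ j, w j) - 1) * φ 0 := by
        rw [mul_div_cancel₀ _ hsum_pos.ne']
        ring
end

section
/- Let a > 0, let φ : ℝ → ℝ be convex on [0,a], and let t_1, …, t_n ∈ [0,a] be real numbers with 0 < ∑_{k=1}^n t_k ≤ a. Then ∑_{k=1}^n φ(t_k) ≤ φ(∑_{k=1}^n t_k) + (n−1) · φ(0). -/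
/-- Unweighted Petrović inequality: let `a > 0`, `φ` convex on `[0,a]`, and
`t 1, …, t n ∈ [0,a]` with `0 < ∑ t j ≤ a`. Then
`∑ φ(t j) ≤ φ(∑ t j) + (n−1)·φ(0)`. -/
theorem petrovic_unweighted {a : ℝ} (ha : 0 < a) (φ : ℝ → ℝ)
    (hφ : ConvexOn ℝ (Set.Icc 0 a) φ) {n : ℕ} (t : Fin n → ℝ)
    (ht : ∀ j, t j ∈ Set.Icc 0 a)
    (hsum_pos : 0 < ∑ j, t j) (hsum_le : ∑ j, t j ≤ a) :
    ∑ j, φ (t j) ≤ φ (∑ j, t j) + ((n : ℝ) - 1) * φ 0 := by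
  obtain ⟨S, hS⟩ : ∃ S, S = ∑ j, t j := ⟨_, rfl⟩
  rw [← hS] at hsum_pos hsum_le ⊢
  have hne : S ≠ 0 := hsum_pos.ne'
  have key : ∀ j ∈ Finset.univ, φ (t j) ≤ t j / S * φ S + (1 - t j / S) * φ 0 := by
    intro j _
    have hle : t j ≤ S := by
      rw [hS]
      exact Finset.single_le_sum (fun i _ => (ht i).1) (Finset.mem_univ j)
    have h1 : t j / S ≤ 1 := (div_le_one hsum_pos).2 hle
    have h := hφ.2 (x := S) ⟨hsum_pos.le, hsum_le⟩ (y := 0) ⟨le_rfl, ha.le⟩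
      (div_nonneg (ht j).1 hsum_pos.le) (sub_nonneg.2 h1) (by ring)
    simpa [div_mul_cancel₀ _ hne] using h
  refine (Finset.sum_le_sum key).trans (le_of_eq ?_)
  rw [Finset.sum_add_distrib, ← Finset.sum_mul, ← Finset.sum_mul, Finset.sum_sub_distrib,
    ← Finset.sum_div, ← hS, div_self hne]
  simp
end
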